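/- Let d ≥ 2 be an even integer, let e be an indeterminate, and let n be a positive integer with n ≡ d+1 (mod 2d). Then the following identity of rational functions in q and e holds: Σ_{k=0}^{(n−1)/d} [3dk−1]_q · (q^{−1},e,q^{d−1}/e; q^{2d})_k (q^{1−n},q^{1+n},q^{d−3}; q^d)_k / ((q^d,e,q^{d−1}/e; q^d)_k (q^{2d−2−n},q^{2d−2+n},q^{d+2}; q^{2d})_k) · q^{dk} = 0. -/

import Mathlib

open Finset

noncomputable section

abbrev R2 : Type := MvPolynomial (Fin 2) ℚ
abbrev K2 : Type := FractionRing R2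

/-- The variable `q` as a rational function in `ℚ(q,e)`. -/
def qv : K2 := algebraMap R2 K2 (MvPolynomial.X 0)

/-- The indeterminate `e` as a rational function in `ℚ(q,e)`. -/
def ev : K2 := algebraMap R2 K2 (MvPolynomial.X 1)

/-- The q-shifted factorial `(a; q)_k = (1-a)(1-aq)⋯(1-aq^{k-1})`. -/
def qPoch {R : Type*} [CommRing R] (a q : R) (k : ℕ) : R :=
  ∏ j ∈ Finset.range k, (1 - a * q ^ j)

/-- The q-integer `[m]_q = (1 - q^m)/(1 - q)`. -/
def qInt {K : Type*} [Field K] (q : K) (m : ℤ) : K := (1 - q ^ m) / (1 - q)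


section QPochhammer

variable {K : Type*} [Field K]

lemma qPoch_zero (a q : K) : qPoch a q 0 = 1 := by simp [qPoch]

lemma qPoch_succ (a q : K) (k : ℕ) : qPoch a q (k + 1) = qPoch a q k * (1 - a * q ^ k) :=
  Finset.prod_range_succ _ _

lemma qPoch_add (a q : K) (m k : ℕ) :
    qPoch a q (m + k) = qPoch a q m * qPoch (a * q ^ m) q k := by
  simp only [qPoch, Finset.prod_range_add]
  congr 1
  exact Finset.prod_congr rfl fun j _ => by ring

lemma qPoch_shift (a q : K) (k : ℕ) :
    (1 - a) * qPoch (a * q) q k = qPoch a q k * (1 - a * q ^ k) := by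
  rw [← qPoch_succ, add_comm, qPoch_add, qPoch_succ, qPoch_zero]
  simp

lemma qPoch_eq_zero {a q : K} {j k : ℕ} (hjk : j < k) (h : a * q ^ j = 1) : qPoch a q k = 0 :=
  Finset.prod_eq_zero (Finset.mem_range.mpr hjk) (by rw [h, sub_self])

/-- The hypergeometric part of the quadratic summand with parameters `a`, `b`, `c`. -/
def quadCore (p a b c : K) (i : ℕ) : K :=
  qPoch a (p ^ 2) i * qPoch b p i * qPoch c p i * qPoch (a * p / (b * c)) p i /
    (qPoch p p i * qPoch (a * p ^ 2 / b) (p ^ 2) i * qPoch (a * p ^ 2 / c) (p ^ 2) i *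
      qPoch (b * c * p) (p ^ 2) i) * p ^ (i + i.choose 2)

/-- The very-well-poised summand `(1 - a p^{3i})` times `quadCore`. -/
def quadTerm (p a b c : K) (i : ℕ) : K := (1 - a * p ^ (3 * i)) * quadCore p a b c i

lemma quadCore_succ (p a b c : K) (i : ℕ) :
    quadCore p a b c (i + 1) = quadCore p a b c i *
      ((1 - a * (p ^ i) ^ 2) * (1 - b * p ^ i) * (1 - c * p ^ i) *
        (1 - a * p / (b * c) * p ^ i) /
      ((1 - p * p ^ i) * (1 - a * p ^ 2 / b * (p ^ i) ^ 2) * (1 - a * p ^ 2 / c * (p ^ i) ^ 2) *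
        (1 - b * c * p * (p ^ i) ^ 2)) * (p * p ^ i)) := by
  simp only [quadCore, qPoch_succ, Nat.choose_succ_succ' i 1, Nat.choose_one_right, ← pow_mul,
    mul_comm i 2]
  generalize 1 - p * p ^ i = x₁
  generalize 1 - a * p ^ 2 / b * p ^ (2 * i) = x₂
  generalize 1 - a * p ^ 2 / c * p ^ (2 * i) = x₃
  generalize 1 - b * c * p * p ^ (2 * i) = x₄
  ring

/-- Replacing `b` by `b p²` in the quadratic summand. -/
lemma quadCore_shift {p a b c : K} (hp : p ≠ 0) (hb : b ≠ 0) (hc : c ≠ 0)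
    (hab : ∀ m : ℤ, a * p ^ m ≠ b) (habc : ∀ m : ℤ, a * p ^ m ≠ b * c)
    (hbc : ∀ m : ℕ, b * c * p ^ (m + 1) ≠ 1) (i : ℕ) :
    (1 - b) * (1 - b * p) * (1 - a / b) * quadCore p a (b * p ^ 2) c i =
      (1 - a / (b * c)) * (1 - b * c * p) * (1 - b * p ^ i) * (1 - b * p * p ^ i) *
        (1 - a / (b * c * p)) * (1 - a / b * (p ^ i) ^ 2) /
        ((1 - a / (b * c * p) * p ^ i) * (1 - a / (b * c) * p ^ i) *
          (1 - b * c * p * (p ^ i) ^ 2)) * quadCore p a b c i := by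
  have hs (m : ℤ) : 1 - a / (b * c) * p ^ m ≠ 0 := fun h => habc m (by
    field_simp at h
    linear_combination -h)
  have hu (m : ℤ) : 1 - a / b * p ^ m ≠ 0 := fun h => hab m (by
    field_simp at h
    linear_combination -h)
  have hg (m : ℕ) : 1 - b * c * p * p ^ m ≠ 0 := fun h => hbc m (by linear_combination -h)
  have hs0 : 1 - a / (b * c) * p ^ i ≠ 0 := by exact_mod_cast hs i
  have hs1 : 1 - a / (b * c * p) * p ^ i ≠ 0 := by
    have := hs (i - 1)
    rw [zpow_sub_one₀ hp, zpow_natCast] at this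
    convert this using 2
    field_simp
  have hg0 : 1 - b * c * p * (p ^ i) ^ 2 ≠ 0 := by
    have := hg (i * 2)
    rwa [pow_mul] at this
  have hg00 : 1 - b * c * p ≠ 0 := by simpa using hg 0
  have hu0 : 1 - a / b ≠ 0 := by simpa using hu 0
  have hu1 : 1 - a / b * (p ^ i) ^ 2 ≠ 0 := by
    have := hu (i * 2 : ℕ)
    rwa [zpow_natCast, pow_mul] at this
  have eb : (1 - b) * (1 - b * p) * qPoch (b * p ^ 2) p i =
      qPoch b p i * ((1 - b * p ^ i) * (1 - b * p * p ^ i)) := by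
    have h1 := qPoch_shift b p i
    have h2 := qPoch_shift (b * p) p i
    rw [show b * p ^ 2 = b * p * p by ring]
    linear_combination (1 - b) * h2 + (1 - b * p * p ^ i) * h1
  have hx : 1 - a / (b * c * p) ≠ 0 := by
    have := hs (-1)
    rw [zpow_neg_one] at this
    convert this using 2
    field_simp
  have hy : 1 - a / (b * c) ≠ 0 := by simpa using hs 0
  have es : qPoch (a * p / (b * c)) p i = (1 - a / (b * c * p) * p ^ i) *
      (1 - a / (b * c) * p ^ i) * qPoch (a * p / (b * p ^ 2 * c)) p i /
        ((1 - a / (b * c * p)) * (1 - a / (b * c))) := by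
    have h1 := qPoch_shift (a / (b * c * p)) p i
    have h2 := qPoch_shift (a / (b * c)) p i
    rw [show a / (b * c * p) * p = a / (b * c) by field_simp] at h1
    rw [show a / (b * c) * p = a * p / (b * c) by ring] at h2
    rw [show a * p / (b * p ^ 2 * c) = a / (b * c * p) by field_simp,
      eq_div_iff (mul_ne_zero hx hy)]
    linear_combination (1 - a / (b * c * p)) * h2 + (1 - a / (b * c) * p ^ i) * h1
  have eu : qPoch (a * p ^ 2 / b) (p ^ 2) i = qPoch (a * p ^ 2 / (b * p ^ 2)) (p ^ 2) i *
      (1 - a / b * (p ^ i) ^ 2) / (1 - a / b) := by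
    have h1 := qPoch_shift (a / b) (p ^ 2) i
    rw [show a / b * p ^ 2 = a * p ^ 2 / b by ring] at h1
    rw [show a * p ^ 2 / (b * p ^ 2) = a / b by field_simp, eq_div_iff hu0, mul_comm, h1]
    ring
  have eg : qPoch (b * p ^ 2 * c * p) (p ^ 2) i = qPoch (b * c * p) (p ^ 2) i *
      (1 - b * c * p * (p ^ i) ^ 2) / (1 - b * c * p) := by
    have h1 := qPoch_shift (b * c * p) (p ^ 2) i
    rw [eq_div_iff hg00, show b * p ^ 2 * c * p = b * c * p * p ^ 2 by ring, mul_comm, h1]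
    ring
  simp only [quadCore]
  rw [es, eu, eg]
  generalize qPoch (a * p ^ 2 / (b * p ^ 2)) (p ^ 2) i = U at *
  generalize qPoch (b * c * p) (p ^ 2) i = G at *
  generalize qPoch (a * p / (b * p ^ 2 * c)) p i = S at *
  generalize 1 - a / (b * c) * p ^ i = x₁ at *
  generalize 1 - a / (b * c * p) * p ^ i = x₂ at *
  generalize 1 - b * c * p * (p ^ i) ^ 2 = x₃ at *
  generalize 1 - b * c * p = x₄ at *
  generalize 1 - a / b * (p ^ i) ^ 2 = x₅ at *
  generalize 1 - a / b = x₆ at *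
  generalize 1 - a / (b * c * p) = x₇ at *
  generalize 1 - a / (b * c) = x₈ at *
  generalize qPoch (b * p ^ 2) p i = B' at *
  generalize (1 - b) * (1 - b * p) = y at *
  trans (y * B') * (x₆ * (qPoch a (p ^ 2) i * qPoch c p i * S /
    (qPoch p p i * U * qPoch (a * p ^ 2 / c) (p ^ 2) i * (G * x₃ / x₄)) * p ^ (i + i.choose 2)))
  · ring
  rw [eb]
  field_simp

/-- The telescoping certificate for `b ↦ b p²`. -/
def quadCert (p a b c : K) (i : ℕ) : K :=
  (1 - a / (b * c)) * (1 - b * c * p) * (b - a / (b * c * p)) *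
    ((1 - p ^ i) * (1 - a / b * (p ^ i) ^ 2) * (1 - a / c * (p ^ i) ^ 2)) /
    ((1 - a / (b * c * p) * p ^ i) * (1 - a / (b * c) * p ^ i)) * quadCore p a b c i

lemma sum_quadTerm_telescope {p a b c : K} (hp : p ≠ 0) (hp1 : ∀ m : ℕ, p ^ (m + 1) ≠ 1)
    (hb : b ≠ 0) (hc : c ≠ 0) (hab : ∀ m : ℤ, a * p ^ m ≠ b) (hac : ∀ m : ℤ, a * p ^ m ≠ c)
    (habc : ∀ m : ℤ, a * p ^ m ≠ b * c) (hbc : ∀ m : ℕ, b * c * p ^ (m + 1) ≠ 1) (M : ℕ) :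
    (1 - b) * (1 - a / (b * c)) * (1 - b * c * p) * ∑ i ∈ range M, quadTerm p a b c i -
      (1 - b) * (1 - b * p) * (1 - a / b) * ∑ i ∈ range M, quadTerm p a (b * p ^ 2) c i =
      quadCert p a b c M := by
  induction M with
  | zero => simp [quadCert]
  | succ i ih =>
    have hshift := quadCore_shift hp hb hc hab habc hbc i
    have hcert : quadCert p a b c i + (1 - b) * (1 - a / (b * c)) * (1 - b * c * p) *
        quadTerm p a b c i - (1 - a * p ^ (3 * i)) *
        ((1 - b) * (1 - b * p) * (1 - a / b) * quadCore p a (b * p ^ 2) c i) =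
        quadCert p a b c (i + 1) := by
      rw [hshift]
      simp only [quadCert, quadTerm, quadCore_succ, pow_succ' p i, mul_comm 3 i, pow_mul]
      have h1 : b * c - a * p ^ i ≠ 0 := by
        have := habc i
        rw [zpow_natCast] at this
        exact sub_ne_zero.mpr this.symm
      have h2 : b * c * p - a * p ^ i ≠ 0 := fun h => habc (i - 1) (by
        rw [zpow_sub_one₀ hp, zpow_natCast]
        field_simp
        linear_combination -h)
      have h3 : b * c - a * p * p ^ i ≠ 0 := fun h => habc (i + 1) (by
        rw [zpow_add_one₀ hp, zpow_natCast]
        linear_combination -h)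
      have h4 : b - a * p ^ 2 * (p ^ i) ^ 2 ≠ 0 := fun h => hab (2 * i + 2 : ℕ) (by
        rw [zpow_natCast]
        linear_combination -h)
      have h5 : c - a * p ^ 2 * (p ^ i) ^ 2 ≠ 0 := fun h => hac (2 * i + 2 : ℕ) (by
        rw [zpow_natCast]
        linear_combination -h)
      have h6 : 1 - p * p ^ i ≠ 0 := fun h => hp1 i (by linear_combination -h)
      have h7 : 1 - b * c * p * (p ^ i) ^ 2 ≠ 0 := fun h => hbc (2 * i) (by
        linear_combination -h)
      generalize quadCore p a b c i = Q
      generalize p ^ i = X at *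
      have e1 : 1 - a / (b * c) * X = (b * c - a * X) / (b * c) := by field_simp
      have e2 : 1 - a / (b * c * p) * X = (b * c * p - a * X) / (b * c * p) := by field_simp
      have e3 : 1 - a / (b * c * p) * (p * X) = (b * c - a * X) / (b * c) := by field_simp
      have e4 : 1 - a / (b * c) * (p * X) = (b * c - a * p * X) / (b * c) := by field_simp
      have e5 : 1 - a * p / (b * c) * X = (b * c - a * p * X) / (b * c) := by field_simp
      have e6 : 1 - a / b * (p * X) ^ 2 = (b - a * p ^ 2 * X ^ 2) / b := by field_simp
      have e7 : 1 - a / c * (p * X) ^ 2 = (c - a * p ^ 2 * X ^ 2) / c := by field_simp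
      have e8 : 1 - a * p ^ 2 / b * X ^ 2 = (b - a * p ^ 2 * X ^ 2) / b := by field_simp
      have e9 : 1 - a * p ^ 2 / c * X ^ 2 = (c - a * p ^ 2 * X ^ 2) / c := by field_simp
      rw [e1, e2, e3, e4, e5, e6, e7, e8, e9]
      obtain ⟨y₁, hy₁⟩ : ∃ y, y = b * c - a * X := ⟨_, rfl⟩
      obtain ⟨y₂, hy₂⟩ : ∃ y, y = b * c * p - a * X := ⟨_, rfl⟩
      obtain ⟨y₃, hy₃⟩ : ∃ y, y = b * c - a * p * X := ⟨_, rfl⟩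
      obtain ⟨y₄, hy₄⟩ : ∃ y, y = b - a * p ^ 2 * X ^ 2 := ⟨_, rfl⟩
      obtain ⟨y₅, hy₅⟩ : ∃ y, y = c - a * p ^ 2 * X ^ 2 := ⟨_, rfl⟩
      obtain ⟨y₆, hy₆⟩ : ∃ y, y = 1 - p * X := ⟨_, rfl⟩
      obtain ⟨y₇, hy₇⟩ : ∃ y, y = 1 - b * c * p * X ^ 2 := ⟨_, rfl⟩
      rw [← hy₁, ← hy₂, ← hy₃, ← hy₄, ← hy₅, ← hy₆, ← hy₇]
      rw [← hy₁] at h1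
      rw [← hy₂] at h2
      rw [← hy₃] at h3
      rw [← hy₄] at h4
      rw [← hy₅] at h5
      rw [← hy₆] at h6
      rw [← hy₇] at h7
      field_simp
      rw [hy₁, hy₂, hy₇]
      ring
    rw [sum_range_succ, sum_range_succ, ← hcert, ← ih]
    simp only [quadTerm]
    ring

/-- The quadratic sum with `b = p^{-N}` vanishes for odd `N`. -/
lemma sum_quadTerm_odd {p a c : K} (hp : p ≠ 0) (hp1 : ∀ m : ℕ, p ^ (m + 1) ≠ 1)
    (hc : c ≠ 0) (ha : ∀ m : ℤ, a * p ^ m ≠ 1) (hac : ∀ m : ℤ, a * p ^ m ≠ c) (r M : ℕ)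
    (hM : 2 * r + 1 < M) (hcp : ∀ m : ℤ, -(2 * r + 1 : ℤ) < m → c * p ^ m ≠ 1) :
    ∑ i ∈ range M, quadTerm p a (p ^ (-(2 * r + 1 : ℤ))) c i = 0 := by
  have hab (s : ℕ) (m : ℤ) : a * p ^ m ≠ p ^ (-(2 * s + 1 : ℤ)) := fun h =>
    ha (m + (2 * s + 1)) (by
      rw [zpow_add₀ hp, ← mul_assoc, h, ← zpow_add₀ hp, neg_add_cancel, zpow_zero])
  have habc (s : ℕ) (m : ℤ) : a * p ^ m ≠ p ^ (-(2 * s + 1 : ℤ)) * c := fun h =>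
    hac (m + (2 * s + 1)) (by
      rw [zpow_add₀ hp, ← mul_assoc, h, mul_right_comm, ← zpow_add₀ hp, neg_add_cancel,
        zpow_zero, one_mul])
  have hb1 (s : ℕ) : p ^ (-(2 * s + 1 : ℤ)) ≠ 1 := fun h => hp1 (2 * s) (by
    rw [zpow_neg, inv_eq_one] at h
    exact_mod_cast h)
  have step (s : ℕ) (hs : 2 * s + 1 < M)
      (hcs : ∀ m : ℤ, -(2 * s + 1 : ℤ) < m → c * p ^ m ≠ 1)
      (h0 : (1 - p ^ (-(2 * s + 1 : ℤ)) * p) *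
        ∑ i ∈ range M, quadTerm p a (p ^ (-(2 * s + 1 : ℤ)) * p ^ 2) c i = 0) :
      ∑ i ∈ range M, quadTerm p a (p ^ (-(2 * s + 1 : ℤ))) c i = 0 := by
    have hbc (m : ℕ) : p ^ (-(2 * s + 1 : ℤ)) * c * p ^ (m + 1) ≠ 1 := fun h =>
      hcs (m - 2 * s) (by omega) (by
        rw [← h, ← zpow_natCast, mul_right_comm, ← zpow_add₀ hp, mul_comm]
        congr 2
        push_cast
        ring)
    have hb0 : p ^ (-(2 * s + 1 : ℤ)) ≠ 0 := zpow_ne_zero _ hp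
    have htel := sum_quadTerm_telescope hp hp1 hb0 hc (hab s) hac (habc s) hbc M
    have hcert : quadCert p a (p ^ (-(2 * s + 1 : ℤ))) c M = 0 := by
      have hz : qPoch (p ^ (-(2 * s + 1 : ℤ))) p M = 0 := qPoch_eq_zero hs (by
        rw [← zpow_natCast, ← zpow_add₀ hp]
        simp)
      simp only [quadCert, quadCore, hz, mul_zero, zero_mul, zero_div]
    have hbc0 := hbc 0
    have habc0 := habc s 0
    have hbs := hb1 s
    rw [zero_add, pow_one] at hbc0
    rw [zpow_zero, mul_one] at habc0
    rw [hcert] at htel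
    have hprod : (1 - p ^ (-(2 * s + 1 : ℤ))) * (1 - a / (p ^ (-(2 * s + 1 : ℤ)) * c)) *
        (1 - p ^ (-(2 * s + 1 : ℤ)) * c * p) *
        ∑ i ∈ range M, quadTerm p a (p ^ (-(2 * s + 1 : ℤ))) c i = 0 := by
      linear_combination htel +
        (1 - p ^ (-(2 * s + 1 : ℤ))) * (1 - a / p ^ (-(2 * s + 1 : ℤ))) * h0
    refine (mul_eq_zero.mp hprod).resolve_left (mul_ne_zero (mul_ne_zero ?_ ?_) ?_)
    · exact sub_ne_zero.mpr hbs.symm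
    · refine sub_ne_zero.mpr fun h => habc0 ?_
      rwa [eq_comm, div_eq_one_iff_eq (mul_ne_zero hb0 hc)] at h
    · exact sub_ne_zero.mpr hbc0.symm
  induction r with
  | zero =>
    refine step 0 hM hcp ?_
    simp [hp]
  | succ r ih =>
    refine step (r + 1) hM hcp ?_
    have hb : p ^ (-(2 * (r + 1 : ℕ) + 1 : ℤ)) * p ^ 2 = p ^ (-(2 * r + 1 : ℤ)) := by
      rw [← zpow_natCast p 2, ← zpow_add₀ hp]
      exact congrArg _ (by push_cast; ring)
    rw [hb, ih (by omega) fun m hm => hcp m (by push_cast; omega), mul_zero]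

/-- `p^{i(i-1)/2} / (p; p)_i`, extended by zero to negative `i`. -/
def expWeight (p : K) (i : ℤ) : K :=
  if i < 0 then 0 else p ^ i.toNat.choose 2 / qPoch p p i.toNat

lemma expWeight_of_neg (p : K) {i : ℤ} (hi : i < 0) : expWeight p i = 0 := if_pos hi

lemma expWeight_natCast (p : K) (i : ℕ) :
    expWeight p i = p ^ i.choose 2 / qPoch p p i := by
  simp [expWeight]

lemma expWeight_succ {p : K} (hp1 : ∀ m : ℕ, p ^ (m + 1) ≠ 1) (i : ℤ) :
    expWeight p i * p ^ i = (1 - p ^ (i + 1)) * expWeight p (i + 1) := by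
  obtain hi | hi | hi : i + 1 < 0 ∨ i + 1 = 0 ∨ 0 ≤ i := by omega
  · rw [expWeight_of_neg p hi, expWeight_of_neg p (by omega), zero_mul, mul_zero]
  · rw [hi, expWeight_of_neg p (by omega)]
    simp
  · lift i to ℕ using hi
    have h1 : 1 - p * p ^ i ≠ 0 := fun h => hp1 i (by linear_combination -h)
    have h2 : (1 : K) - p ^ ((i : ℤ) + 1) = 1 - p * p ^ i := by
      rw [← pow_succ']
      norm_cast
    rw [h2, show (i : ℤ) + 1 = (i + 1 : ℕ) by norm_cast, expWeight_natCast, expWeight_natCast,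
      qPoch_succ, Nat.choose_succ_succ' i 1, Nat.choose_one_right, zpow_natCast, pow_add]
    generalize 1 - p * p ^ i = x at *
    field_simp

/-- The summand in the expansion of `(a, e, ap/e; p²)_k / (p, e, ap/e; p)_k`. -/
def expTerm (p a e : K) (k j : ℕ) : K :=
  expWeight p (k - 2 * j) * qPoch a (p ^ 2) (k + j) /
    (qPoch (p ^ 2) (p ^ 2) j * qPoch (e * p) (p ^ 2) j * qPoch (a * p ^ 2 / e) (p ^ 2) j)

lemma sum_expTerm_telescope {p a e : K} (hp : p ≠ 0) (hp1 : ∀ m : ℕ, p ^ (m + 1) ≠ 1)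
    (he0 : e ≠ 0) (he : ∀ m : ℕ, e * p ^ m ≠ 1) (hae : ∀ m : ℕ, a * p ^ (m + 1) ≠ e)
    (k M : ℕ) :
    (1 - p * p ^ k) * (1 - e * p ^ k) * (1 - a * p / e * p ^ k) *
        ∑ j ∈ range M, expTerm p a e (k + 1) j -
      (1 - a * (p ^ k) ^ 2) * (1 - e * (p ^ k) ^ 2) * (1 - a * p / e * (p ^ k) ^ 2) *
        ∑ j ∈ range M, expTerm p a e k j =
      -(p * p ^ k * (1 - a * p * (p ^ k) ^ 3)) / (p ^ M) ^ 2 *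
        ((1 - (p ^ M) ^ 2) * (1 - e * (p ^ M) ^ 2 / p) * (1 - a / e * (p ^ M) ^ 2)) *
        (expWeight p (k + 1 - 2 * M) * qPoch a (p ^ 2) (k + M) /
          (qPoch (p ^ 2) (p ^ 2) M * qPoch (e * p) (p ^ 2) M *
            qPoch (a * p ^ 2 / e) (p ^ 2) M)) := by
  induction M with
  | zero => simp
  | succ M ih =>
    have hX : p ^ k ≠ 0 := pow_ne_zero _ hp
    have hY : p ^ M ≠ 0 := pow_ne_zero _ hp
    have hz : p ^ ((k : ℤ) - 2 * M) = p ^ k / (p ^ M) ^ 2 := by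
      rw [zpow_sub₀ hp, zpow_natCast, mul_comm, zpow_mul, zpow_natCast]
      norm_cast
    have hz' : p ^ ((k : ℤ) - 2 * M - 1) = p ^ k / (p ^ M) ^ 2 / p := by
      rw [zpow_sub_one₀ hp, hz]
      ring
    have w1 : expWeight p (k - 2 * M) =
        ((p ^ M) ^ 2 - p * p ^ k) / p ^ k * expWeight p (k + 1 - 2 * M) := by
      have h := expWeight_succ hp1 ((k : ℤ) - 2 * M)
      rw [zpow_add_one₀ hp, hz, show (k : ℤ) - 2 * M + 1 = k + 1 - 2 * M by ring] at h
      field_simp at h ⊢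
      linear_combination h
    have w2 : expWeight p (k + 1 - 2 * (M + 1 : ℕ)) =
        p * ((p ^ M) ^ 2 - p ^ k) / p ^ k * expWeight p (k - 2 * M) := by
      have h := expWeight_succ hp1 ((k : ℤ) - 2 * M - 1)
      rw [sub_add_cancel, hz', hz] at h
      rw [show (k : ℤ) + 1 - 2 * (M + 1 : ℕ) = k - 2 * M - 1 by push_cast; ring]
      field_simp at h ⊢
      linear_combination h
    have h1 : 1 - p ^ 2 * (p ^ M) ^ 2 ≠ 0 := fun h => hp1 (2 * M + 1) (by
      linear_combination -h)
    have h2 : 1 - e * p * (p ^ M) ^ 2 ≠ 0 := fun h => he (2 * M + 1) (by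
      linear_combination -h)
    have h3 : e - a * p ^ 2 * (p ^ M) ^ 2 ≠ 0 := fun h => hae (2 * M + 1) (by
      linear_combination -h)
    rw [sum_range_succ, sum_range_succ, mul_add, mul_add, add_sub_add_comm, ih]
    rw [w2]
    simp only [expTerm, show ((k + 1 : ℕ) : ℤ) - 2 * M = k + 1 - 2 * M by push_cast; ring]
    rw [w1]
    have hq (x : K) : x * (p ^ 2) ^ M = x * (p ^ M) ^ 2 := by rw [← pow_mul, ← pow_mul, mul_comm M]
    simp only [show k + 1 + M = k + M + 1 by ring, show k + (M + 1) = k + M + 1 by ring,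
      qPoch_succ, hq]
    have hk : a * (p ^ 2) ^ (k + M) = a * (p ^ k) ^ 2 * (p ^ M) ^ 2 := by ring
    rw [hk, pow_succ' p M]
    generalize expWeight p (k + 1 - 2 * M) = W
    generalize qPoch a (p ^ 2) (k + M) = A
    generalize qPoch (p ^ 2) (p ^ 2) M = B₁
    generalize qPoch (e * p) (p ^ 2) M = B₂
    generalize qPoch (a * p ^ 2 / e) (p ^ 2) M = B₃
    generalize p ^ k = X at *
    generalize p ^ M = Y at *
    have e1 : 1 - a * p ^ 2 / e * Y ^ 2 = (e - a * p ^ 2 * Y ^ 2) / e := by field_simp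
    have e2 : 1 - a / e * (p * Y) ^ 2 = (e - a * p ^ 2 * Y ^ 2) / e := by field_simp
    have e3 : 1 - e * (p * Y) ^ 2 / p = 1 - e * p * Y ^ 2 := by field_simp
    have e4 : 1 - (p * Y) ^ 2 = 1 - p ^ 2 * Y ^ 2 := by ring
    rw [e1, e2, e3, e4]
    generalize e - a * p ^ 2 * Y ^ 2 = y₁ at *
    generalize 1 - e * p * Y ^ 2 = y₂ at *
    generalize 1 - p ^ 2 * Y ^ 2 = y₃ at *
    field_simp
    ring

lemma sum_expTerm {p a e : K} (hp : p ≠ 0) (hp1 : ∀ m : ℕ, p ^ (m + 1) ≠ 1)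
    (he0 : e ≠ 0) (he : ∀ m : ℕ, e * p ^ m ≠ 1) (hae : ∀ m : ℕ, a * p ^ (m + 1) ≠ e)
    (k M : ℕ) (hM : k < 2 * M) :
    ∑ j ∈ range M, expTerm p a e k j =
      qPoch a (p ^ 2) k * qPoch e (p ^ 2) k * qPoch (a * p / e) (p ^ 2) k /
        (qPoch p p k * qPoch e p k * qPoch (a * p / e) p k) := by
  induction k with
  | zero =>
    rw [sum_eq_single_of_mem 0 (mem_range.mpr (by omega))]
    · simp [expTerm, qPoch_zero, expWeight]
    · intro j _ hj
      rw [expTerm, expWeight_of_neg p (by omega)]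
      simp
  | succ k ih =>
    have h := sum_expTerm_telescope hp hp1 he0 he hae k M
    have h1 : 1 - p * p ^ k ≠ 0 := fun h => hp1 k (by linear_combination -h)
    have h2 : 1 - e * p ^ k ≠ 0 := sub_ne_zero.mpr (he k).symm
    have h3 : 1 - a * p / e * p ^ k ≠ 0 := fun h => hae k (by
      field_simp at h
      linear_combination -h)
    rw [expWeight_of_neg p (by omega), ih (by omega), zero_mul, zero_div, mul_zero, sub_eq_zero]
      at h
    rw [← mul_right_inj' (mul_ne_zero (mul_ne_zero h1 h2) h3), h]
    have hq (x : K) : x * (p ^ 2) ^ k = x * (p ^ k) ^ 2 := by rw [← pow_mul, ← pow_mul, mul_comm k]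
    simp only [qPoch_succ, hq]
    generalize 1 - p * p ^ k = x₁ at *
    generalize 1 - e * p ^ k = x₂ at *
    generalize 1 - a * p / e * p ^ k = x₃ at *
    field_simp

/-- The terminating quadratic summation with `b = p^{-N}`, `N` odd, vanishes. -/
lemma sum_quadratic_odd {p a c e : K} (hp : p ≠ 0) (hp1 : ∀ m : ℕ, p ^ (m + 1) ≠ 1)
    (hc : c ≠ 0) (ha : ∀ m : ℤ, a * p ^ m ≠ 1) (hac : ∀ m : ℤ, a * p ^ m ≠ c)
    (he0 : e ≠ 0) (he : ∀ m : ℕ, e * p ^ m ≠ 1) (hae : ∀ m : ℕ, a * p ^ (m + 1) ≠ e) (r : ℕ)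
    (hcp : ∀ m : ℤ, -(2 * r + 1 : ℤ) < m → c * p ^ m ≠ 1) {b : K}
    (hb : b = p ^ (-(2 * r + 1 : ℤ))) :
    ∑ k ∈ range (2 * r + 2), (1 - a * p ^ (3 * k)) *
      (qPoch a (p ^ 2) k * qPoch e (p ^ 2) k * qPoch (a * p / e) (p ^ 2) k /
        (qPoch p p k * qPoch e p k * qPoch (a * p / e) p k)) *
      (qPoch b p k * qPoch c p k * qPoch (a * p / (b * c)) p k /
        (qPoch (a * p ^ 2 / b) (p ^ 2) k * qPoch (a * p ^ 2 / c) (p ^ 2) k *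
          qPoch (b * c * p) (p ^ 2) k)) * p ^ k = 0 := by
  have hb0 : b ≠ 0 := hb ▸ zpow_ne_zero _ hp
  have hexp : ∀ k ∈ range (2 * r + 2), (1 - a * p ^ (3 * k)) *
      (qPoch a (p ^ 2) k * qPoch e (p ^ 2) k * qPoch (a * p / e) (p ^ 2) k /
        (qPoch p p k * qPoch e p k * qPoch (a * p / e) p k)) *
      (qPoch b p k * qPoch c p k * qPoch (a * p / (b * c)) p k /
        (qPoch (a * p ^ 2 / b) (p ^ 2) k * qPoch (a * p ^ 2 / c) (p ^ 2) k *
          qPoch (b * c * p) (p ^ 2) k)) * p ^ k =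
      ∑ j ∈ range (r + 1), (1 - a * p ^ (3 * k)) * expTerm p a e k j *
      (qPoch b p k * qPoch c p k * qPoch (a * p / (b * c)) p k /
        (qPoch (a * p ^ 2 / b) (p ^ 2) k * qPoch (a * p ^ 2 / c) (p ^ 2) k *
          qPoch (b * c * p) (p ^ 2) k)) * p ^ k := by
    intro k hk
    have hk' := mem_range.mp hk
    rw [← sum_expTerm hp hp1 he0 he hae k (r + 1) (by omega), mul_sum, sum_mul, sum_mul]
  rw [sum_congr rfl hexp, sum_comm]
  refine sum_eq_zero fun j hj => ?_
  obtain ⟨s, rfl⟩ := Nat.exists_eq_add_of_le (Nat.le_of_lt_succ (mem_range.mp hj))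
  rw [show 2 * (j + s) + 2 = 2 * j + (2 * s + 2) by ring, sum_range_add, sum_eq_zero, zero_add]
  swap
  · intro k hk
    have hk' := mem_range.mp hk
    rw [expTerm, expWeight_of_neg p (by omega)]
    simp
  have hterm (i : ℕ) : (1 - a * p ^ (3 * (2 * j + i))) * expTerm p a e (2 * j + i) j *
      (qPoch b p (2 * j + i) * qPoch c p (2 * j + i) * qPoch (a * p / (b * c)) p (2 * j + i) /
        (qPoch (a * p ^ 2 / b) (p ^ 2) (2 * j + i) * qPoch (a * p ^ 2 / c) (p ^ 2) (2 * j + i) *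
          qPoch (b * c * p) (p ^ 2) (2 * j + i))) * p ^ (2 * j + i) =
      qPoch a (p ^ 2) (3 * j) / (qPoch (p ^ 2) (p ^ 2) j * qPoch (e * p) (p ^ 2) j *
          qPoch (a * p ^ 2 / e) (p ^ 2) j) *
        (qPoch b p (2 * j) * qPoch c p (2 * j) * qPoch (a * p / (b * c)) p (2 * j) /
        (qPoch (a * p ^ 2 / b) (p ^ 2) (2 * j) * qPoch (a * p ^ 2 / c) (p ^ 2) (2 * j) *
          qPoch (b * c * p) (p ^ 2) (2 * j))) * p ^ (2 * j) *
      quadTerm p (a * p ^ (6 * j)) (b * p ^ (2 * j)) (c * p ^ (2 * j)) i := by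
    rw [expTerm, show ((2 * j + i : ℕ) : ℤ) - 2 * j = i by push_cast; ring, expWeight_natCast,
      show 2 * j + i + j = 3 * j + i by ring]
    simp only [quadTerm, quadCore, qPoch_add _ _ (2 * j) i, qPoch_add _ _ (3 * j) i]
    have hj0 : p ^ j ≠ 0 := pow_ne_zero _ hp
    have a1 : a * (p ^ 2) ^ (3 * j) = a * p ^ (6 * j) := by ring
    have a2 : a * p ^ (6 * j) * p / (b * p ^ (2 * j) * (c * p ^ (2 * j))) =
        a * p / (b * c) * p ^ (2 * j) := by
      simp only [mul_comm _ j, pow_mul]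
      field_simp
    have a3 (x : K) (hx : x ≠ 0) : a * p ^ (6 * j) * p ^ 2 / (x * p ^ (2 * j)) =
        a * p ^ 2 / x * (p ^ 2) ^ (2 * j) := by
      rw [← pow_mul]
      simp only [← mul_assoc]
      simp only [mul_comm _ j, pow_mul]
      field_simp
    have a4 : b * p ^ (2 * j) * (c * p ^ (2 * j)) * p = b * c * p * (p ^ 2) ^ (2 * j) := by ring
    rw [a1, a2, a3 b hb0, a3 c hc, a4]
    ring
  rw [sum_congr rfl fun i _ => hterm i, ← mul_sum]
  refine mul_eq_zero_of_right _ ?_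
  have hbj : b * p ^ (2 * j) = p ^ (-(2 * s + 1 : ℤ)) := by
    rw [hb, ← zpow_natCast, ← zpow_add₀ hp]
    congr 1
    push_cast
    ring
  rw [hbj]
  refine sum_quadTerm_odd hp hp1 (mul_ne_zero hc (pow_ne_zero _ hp)) (fun m h => ?_)
    (fun m h => ?_) s _ (by omega) fun m hm h => ?_
  · refine ha ((6 * j : ℕ) + m) ?_
    rw [zpow_add₀ hp, zpow_natCast, ← mul_assoc, h]
  · refine hac (4 * j + m) ?_
    rw [zpow_add₀ hp, show (4 * j : ℤ) = (4 * j : ℕ) by push_cast; ring, zpow_natCast]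
    refine mul_right_cancel₀ (pow_ne_zero (2 * j) hp) ?_
    rw [← h]
    ring
  · refine hcp ((2 * j : ℕ) + m) (by push_cast; omega) ?_
    rw [zpow_add₀ hp, zpow_natCast, ← mul_assoc, h]

end QPochhammer

lemma qv_ne_zero : qv ≠ 0 := by
  simp [qv, MvPolynomial.X_ne_zero]

lemma qv_pow_ne_one {m : ℕ} (hm : m ≠ 0) : qv ^ m ≠ 1 := by
  intro h
  rw [qv, ← map_pow, ← map_one (algebraMap R2 K2)] at h
  have h' := congrArg (MvPolynomial.eval fun _ => (2 : ℚ)) (IsFractionRing.injective R2 K2 h)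
  rw [map_pow, MvPolynomial.eval_X, map_one] at h'
  exact (one_lt_pow₀ (by norm_num) hm).ne' h'

lemma qv_zpow_ne_one {m : ℤ} (hm : m ≠ 0) : qv ^ m ≠ 1 := by
  obtain ⟨k, rfl | rfl⟩ := m.eq_nat_or_neg
  · rw [zpow_natCast]
    exact qv_pow_ne_one (by omega)
  · rw [zpow_neg, zpow_natCast, Ne, inv_eq_one]
    exact qv_pow_ne_one (by omega)

lemma ev_ne_zero : ev ≠ 0 := by
  simp [ev, MvPolynomial.X_ne_zero]

lemma ev_mul_qv_pow_ne (k l : ℕ) : ev * qv ^ k ≠ qv ^ l := by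
  intro h
  rw [ev, qv, ← map_pow, ← map_pow, ← map_mul] at h
  have h' := congrArg (MvPolynomial.eval ![(1 : ℚ), 2]) (IsFractionRing.injective R2 K2 h)
  simp at h'

lemma ev_ne_qv_zpow (m : ℤ) : ev ≠ qv ^ m := by
  intro h
  obtain ⟨k, rfl | rfl⟩ := m.eq_nat_or_neg
  · exact ev_mul_qv_pow_ne 0 k (by simpa using h)
  · refine ev_mul_qv_pow_ne k 0 ?_
    rw [h, zpow_neg, zpow_natCast, inv_mul_cancel₀ (pow_ne_zero _ qv_ne_zero), pow_zero]

/-- For even `d ≥ 2` and `n ≡ d+1 (mod 2d)`,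
`Σ_{k=0}^{(n-1)/d} [3dk-1] (q^{-1},e,q^{d-1}/e;q^{2d})_k (q^{1-n},q^{1+n},q^{d-3};q^d)_k /
((q^d,e,q^{d-1}/e;q^d)_k (q^{2d-2-n},q^{2d-2+n},q^{d+2};q^{2d})_k) q^{dk} = 0`. -/
theorem stmt13 (d : ℕ) (hd2 : 2 ≤ d) (hdeven : Even d) (n : ℕ) (hn : 0 < n)
    (hmod : n % (2 * d) = (d + 1) % (2 * d)) :
    (∑ k ∈ Finset.range ((n - 1) / d + 1),
      qInt qv (3 * (d : ℤ) * k - 1) *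
        (qPoch (qv ^ (-1 : ℤ)) (qv ^ (2 * d)) k * qPoch ev (qv ^ (2 * d)) k *
          qPoch (qv ^ ((d : ℤ) - 1) / ev) (qv ^ (2 * d)) k) *
        (qPoch (qv ^ (1 - (n : ℤ))) (qv ^ d) k * qPoch (qv ^ (1 + (n : ℤ))) (qv ^ d) k *
          qPoch (qv ^ ((d : ℤ) - 3)) (qv ^ d) k) /
        (qPoch (qv ^ d) (qv ^ d) k * qPoch ev (qv ^ d) k *
          qPoch (qv ^ ((d : ℤ) - 1) / ev) (qv ^ d) k *
          (qPoch (qv ^ (2 * (d : ℤ) - 2 - n)) (qv ^ (2 * d)) k *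
            qPoch (qv ^ (2 * (d : ℤ) - 2 + n)) (qv ^ (2 * d)) k *
            qPoch (qv ^ (d + 2)) (qv ^ (2 * d)) k)) *
        qv ^ (d * k)) = 0 := by
  obtain ⟨r, rfl⟩ : ∃ r, n = d * (2 * r + 1) + 1 := by
    refine ⟨n / (2 * d), ?_⟩
    have h := Nat.div_add_mod n (2 * d)
    rw [hmod, Nat.mod_eq_of_lt (by omega)] at h
    linarith
  have hrange : (d * (2 * r + 1) + 1 - 1) / d + 1 = 2 * r + 2 := by
    rw [Nat.add_sub_cancel, Nat.mul_div_cancel_left _ (by omega)]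
  have hz (m : ℤ) : (qv ^ d) ^ m = qv ^ (d * m) := by rw [zpow_mul, zpow_natCast]
  have hn' (m : ℕ) : (qv ^ d) ^ m = qv ^ (d * m : ℤ) := by rw [← zpow_natCast, hz]
  have hadd (x y : ℤ) : qv ^ x * qv ^ y = qv ^ (x + y) := (zpow_add₀ qv_ne_zero x y).symm
  have hsub (x y : ℤ) : qv ^ x / qv ^ y = qv ^ (x - y) := (zpow_sub₀ qv_ne_zero x y).symm
  have hd1 : qv ^ d = qv ^ (d : ℤ) := (zpow_natCast _ _).symm
  obtain ⟨t, ht⟩ := hdeven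
  have hodd (m x : ℤ) : d * m ≠ 2 * x + 1 := by
    rw [ht]
    push_cast
    intro h
    have : 2 * (t * m) = 2 * x + 1 := by linarith
    omega
  have key := sum_quadratic_odd (p := qv ^ d) (a := qv ^ (-1 : ℤ))
    (c := qv ^ (1 + ((d * (2 * r + 1) + 1 : ℕ) : ℤ))) (e := ev)
    (pow_ne_zero _ qv_ne_zero)
    (fun m => by
      rw [← pow_mul]
      exact qv_pow_ne_one (by positivity))
    (zpow_ne_zero _ qv_ne_zero)
    (fun m => by
      rw [hz, hadd]
      exact qv_zpow_ne_one fun h => hodd m 0 (by linarith))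
    (fun m h => by
      rw [hz, hadd, ← div_eq_one_iff_eq (zpow_ne_zero _ qv_ne_zero), hsub] at h
      refine qv_zpow_ne_one (fun h' => ?_) h
      refine hodd (m - (2 * r + 1)) 1 ?_
      push_cast at h'
      linarith)
    ev_ne_zero
    (fun m h => ev_mul_qv_pow_ne (d * m) 0 (by rw [pow_mul, h, pow_zero]))
    (fun m => by
      rw [hn', hadd]
      exact (ev_ne_qv_zpow _).symm)
    r
    (fun m hm => by
      rw [hz, hadd]
      refine qv_zpow_ne_one (ne_of_gt ?_)
      push_cast
      have : 0 ≤ (d : ℤ) * (2 * r + 1 + m) := mul_nonneg (by positivity) (by linarith)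
      linarith)
    (b := qv ^ (1 - ((d * (2 * r + 1) + 1 : ℕ) : ℤ)))
    (by
      rw [hz]
      congr 1
      push_cast
      ring)
  rw [hrange]
  refine Eq.trans (sum_congr rfl fun k _ => ?_)
    ((mul_sum (range (2 * r + 2)) _ (1 - qv)⁻¹).symm.trans (by rw [key, mul_zero]))
  have e1 : (qv ^ (2 * d) : K2) = (qv ^ d) ^ 2 := by ring
  have e2 : (qv ^ ((d : ℤ) - 1) : K2) = qv ^ (-1 : ℤ) * qv ^ d := by
    rw [hd1, hadd]
    congr 1
  have e3 : (qv ^ (3 * (d : ℤ) * k - 1) : K2) = qv ^ (-1 : ℤ) * (qv ^ d) ^ (3 * k) := by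
    rw [hn', hadd]
    congr 1
    push_cast
    ring
  set n : ℕ := d * (2 * r + 1) + 1
  have e4 : (qv ^ ((d : ℤ) - 3) : K2) =
      qv ^ (-1 : ℤ) * qv ^ d / (qv ^ (1 - (n : ℤ)) * qv ^ (1 + (n : ℤ))) := by
    rw [hd1, hadd, hadd, hsub]
    congr 1
    ring
  have e5 : (qv ^ (2 * (d : ℤ) - 2 - n) : K2) =
      qv ^ (-1 : ℤ) * (qv ^ d) ^ 2 / qv ^ (1 + (n : ℤ)) := by
    rw [hn', hadd, hsub]
    congr 1
    push_cast
    ring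
  have e6 : (qv ^ (2 * (d : ℤ) - 2 + n) : K2) =
      qv ^ (-1 : ℤ) * (qv ^ d) ^ 2 / qv ^ (1 - (n : ℤ)) := by
    rw [hn', hadd, hsub]
    congr 1
    push_cast
    ring
  have e7 : (qv ^ (d + 2) : K2) = qv ^ (1 - (n : ℤ)) * qv ^ (1 + (n : ℤ)) * qv ^ d := by
    rw [hd1, hadd, hadd, ← zpow_natCast]
    congr 1
    push_cast
    ring
  rw [qInt, e1, e2, e3, e4, e5, e6, e7, pow_mul qv d k]
  generalize (1 : K2) - qv = y
  ring

end
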